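/- For every positive integer n and every Boolean function f : {-1,1}^n → {-1,1} with k(f) ≥ 2, the Fourier max-rank-entropy satisfies max{ √(r(f)) , r(f)/(4·log k(f)) } ≤ k''(f) ≤ k'(f). -/

import Mathlib

open scoped BigOperators
open scoped Classical

noncomputable section

namespace BoolFunc

/-- Real value of a hypercube coordinate: `true ↦ -1`, `false ↦ 1`. -/
def signv (b : Bool) : ℝ := if b then -1 else 1

/-- Fourier coefficient `f̂(S)` of `f : {-1,1}ⁿ → ℝ`. -/
def fourierCoeff {n : ℕ} (f : (Fin n → Bool) → ℝ) (S : Finset (Fin n)) : ℝ :=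
  (∑ x : Fin n → Bool, f x * ∏ i ∈ S, signv (x i)) / 2 ^ n

/-- Fourier support of `f`. -/
def fourierSupport {n : ℕ} (f : (Fin n → Bool) → ℝ) : Finset (Finset (Fin n)) :=
  Finset.univ.filter (fun S => fourierCoeff f S ≠ 0)

/-- Fourier sparsity `k(f)`. -/
def sparsity {n : ℕ} (f : (Fin n → Bool) → ℝ) : ℕ := (fourierSupport f).card

/-- Indicator vector in `F₂ⁿ` of a subset of `[n]`. -/
def indicatorVec {n : ℕ} (S : Finset (Fin n)) : Fin n → ZMod 2 :=
  fun i => if i ∈ S then 1 else 0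

/-- Fourier rank `r(f)`: the `F₂`-dimension of the span of the Fourier support. -/
def fourierRank {n : ℕ} (f : (Fin n → Bool) → ℝ) : ℕ :=
  Module.finrank (ZMod 2)
    ↥(Submodule.span (ZMod 2)
      (indicatorVec '' (fourierSupport f : Set (Finset (Fin n)))))

/-- Weight `δ(f) = Pr[f(x) = -1]`. -/
def weight {n : ℕ} (f : (Fin n → Bool) → ℝ) : ℝ :=
  ((Finset.univ.filter (fun x : Fin n → Bool => f x = -1)).card : ℝ) / 2 ^ n

/-- Fourier max-supp-entropy `k'(f) = max_{S ∈ supp(f)} 1/|f̂(S)|`. -/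
def maxSuppEntropy {n : ℕ} (f : (Fin n → Bool) → ℝ) : ℝ :=
  sSup ((fun S => 1 / |fourierCoeff f S|) '' (fourierSupport f : Set (Finset (Fin n))))

/-- Dimension of the span of `{S : |f̂(S)| ≥ 1/t}`. -/
def levelDim {n : ℕ} (f : (Fin n → Bool) → ℝ) (t : ℝ) : ℕ :=
  Module.finrank (ZMod 2)
    ↥(Submodule.span (ZMod 2)
      (indicatorVec '' {S : Finset (Fin n) | 1 / t ≤ |fourierCoeff f S|}))

/-- Fourier max-rank-entropy `k''(f)`. -/
def maxRankEntropy {n : ℕ} (f : (Fin n → Bool) → ℝ) : ℝ :=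
  sInf {t : ℝ | 0 < t ∧ levelDim f t = fourierRank f}

/-- `f` is Boolean-valued (takes values in `{-1,1}`). -/
def IsBooleanFunc {n : ℕ} (f : (Fin n → Bool) → ℝ) : Prop := ∀ x, f x = 1 ∨ f x = -1

lemma norm_sinh_le_exp_abs_re (w : ℂ) : ‖Complex.sinh w‖ ≤ Real.exp |w.re| := by
  have h1 : ‖Complex.exp w‖ ≤ Real.exp |w.re| := by
    rw [Complex.norm_exp]; exact Real.exp_le_exp.2 (le_abs_self _)
  have h2 : ‖Complex.exp (-w)‖ ≤ Real.exp |w.re| := by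
    rw [Complex.norm_exp, Complex.neg_re]; exact Real.exp_le_exp.2 (neg_le_abs _)
  have h3 : ‖Complex.exp w - Complex.exp (-w)‖ ≤ Real.exp |w.re| + Real.exp |w.re| :=
    (norm_sub_le _ _).trans (add_le_add h1 h2)
  rw [Complex.sinh, norm_div, Complex.norm_two]
  linarith

/-- Two-constants estimate for polynomials bounded on a real segment. -/
lemma norm_eval_sinh_le_rpow (P : Polynomial ℂ) {M : ℝ}
    (hreal : ∀ x : ℝ, |x| ≤ 1 → ‖P.eval (x : ℂ)‖ ≤ 1)
    (hdisc : ∀ z : ℂ, ‖z‖ ≤ 1 → ‖P.eval z‖ ≤ M)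
    (w : ℂ) (h0 : 0 ≤ w.re) (h1 : w.re ≤ 1) :
    ‖P.eval (Complex.I * Real.exp (-1) * Complex.sinh w)‖ ≤ M ^ w.re := by
  set H : ℂ → ℂ := fun w => P.eval (Complex.I * Real.exp (-1) * Complex.sinh w) with hH
  have hdiff : Differentiable ℂ H :=
    P.differentiable.comp (Complex.differentiable_sinh.const_mul _)
  have hsmall : ∀ z : ℂ, 0 ≤ z.re → z.re ≤ 1 → ‖H z‖ ≤ M := by
    intro z hz0 hz1
    apply hdisc
    rw [norm_mul, norm_mul, Complex.norm_I, one_mul, Complex.norm_real, Real.norm_eq_abs,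
      abs_of_pos (Real.exp_pos _)]
    calc Real.exp (-1) * ‖Complex.sinh z‖ ≤ Real.exp (-1) * Real.exp 1 := by
          gcongr
          refine (norm_sinh_le_exp_abs_re z).trans (Real.exp_le_exp.2 ?_)
          rwa [abs_of_nonneg hz0]
      _ = 1 := by rw [← Real.exp_add]; simp
  have key := Complex.HadamardThreeLines.norm_le_interp_of_mem_verticalClosedStrip'
    (f := H) (z := w) (a := 1) (b := M) (l := 0) (u := 1) one_pos ⟨h0, h1⟩
    hdiff.diffContOnCl
    ⟨M, by rintro _ ⟨z, ⟨hz0, hz1⟩, rfl⟩; exact hsmall z hz0 hz1⟩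
    (by
      intro z hz
      have hz : z.re = 0 := hz
      have hzI : z = z.im * Complex.I := by
        apply Complex.ext <;> simp [hz]
      have hval : Complex.I * (Real.exp (-1) : ℂ) * Complex.sinh z
          = ((-(Real.exp (-1) * Real.sin z.im) : ℝ) : ℂ) := by
        rw [hzI, Complex.sinh_mul_I]
        simp only [Complex.mul_im, Complex.ofReal_re, Complex.ofReal_im, Complex.I_re,
          Complex.I_im]
        push_cast
        ring_nf
        simp [Complex.I_sq]
      simp only [hH]
      rw [hval]
      apply hreal
      rw [abs_neg, abs_mul, abs_of_pos (Real.exp_pos _)]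
      exact mul_le_one₀ (Real.exp_le_one_iff.2 (by norm_num)) (abs_nonneg _)
        (Real.abs_sin_le_one _))
    (by
      intro z hz
      have hz : z.re = 1 := hz
      exact hsmall z (by linarith) (by linarith))
  simpa [hH] using key

/-- Bernstein-type bound for the linear coefficient of a polynomial bounded on `[-1, 1]`. -/
lemma norm_coeff_one_le_exp_two_mul_log (P : Polynomial ℂ) {M : ℝ} (hM : Real.exp 1 ≤ M)
    (hreal : ∀ x : ℝ, |x| ≤ 1 → ‖P.eval (x : ℂ)‖ ≤ 1)
    (hdisc : ∀ z : ℂ, ‖z‖ ≤ 1 → ‖P.eval z‖ ≤ M) :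
    ‖P.coeff 1‖ ≤ Real.exp 2 * Real.log M := by
  have hM0 : 0 < M := (Real.exp_pos 1).trans_le hM
  have hlog : 1 ≤ Real.log M := (Real.le_log_iff_exp_le hM0).2 hM
  have hM1 : 1 ≤ M := (Real.one_le_exp zero_le_one).trans hM
  set H : ℂ → ℂ := fun w => P.eval (Complex.I * Real.exp (-1) * Complex.sinh w) with hH
  have hderiv : HasDerivAt H (P.coeff 1 * (Complex.I * Real.exp (-1))) 0 := by
    have h1 : HasDerivAt (fun w => Complex.I * (Real.exp (-1) : ℂ) * Complex.sinh w)
        (Complex.I * Real.exp (-1) * Complex.cosh 0) 0 :=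
      (Complex.hasDerivAt_sinh 0).const_mul _
    have h2 := (P.hasDerivAt (Complex.I * (Real.exp (-1) : ℂ) * Complex.sinh 0)).comp 0 h1
    have hval : P.coeff 1 * (Complex.I * Real.exp (-1)) =
        P.derivative.eval (Complex.I * (Real.exp (-1) : ℂ) * Complex.sinh 0) *
          (Complex.I * Real.exp (-1) * Complex.cosh 0) := by
      simp [← Polynomial.coeff_zero_eq_eval_zero, Polynomial.coeff_derivative]
    rw [hval]
    exact h2
  have hbound : ∀ w : ℂ, |w.re| ≤ 1 → ‖H w‖ ≤ M ^ |w.re| := by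
    intro w hw
    rcases le_total 0 w.re with h | h
    · rw [abs_of_nonneg h] at hw ⊢
      exact norm_eval_sinh_le_rpow P hreal hdisc w h hw
    · rw [abs_of_nonpos h] at hw ⊢
      have := norm_eval_sinh_le_rpow (P.comp (-Polynomial.X))
        (fun x hx => by simpa using hreal (-x) (by simpa using hx))
        (fun z hz => by simpa using hdisc (-z) (by simpa using hz)) (-w) (by simpa using h)
        (by simpa using hw)
      simpa [hH, Complex.sinh_neg] using this
  have hdiff : Differentiable ℂ H :=
    P.differentiable.comp (Complex.differentiable_sinh.const_mul _)
  have hcauchy := Complex.norm_deriv_le_of_forall_mem_sphere_norm_le (f := H) (c := 0)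
    (R := 1 / Real.log M) (C := Real.exp 1) (by positivity) hdiff.diffContOnCl
    (by
      intro z hz
      have hz : ‖z‖ = 1 / Real.log M := by simpa using hz
      have hre : |z.re| ≤ 1 / Real.log M := hz ▸ Complex.abs_re_le_norm z
      have hle : 1 / Real.log M ≤ 1 := (div_le_one (by linarith)).2 hlog
      refine (hbound z (hre.trans hle)).trans ?_
      refine (Real.rpow_le_rpow_of_exponent_le hM1 hre).trans ?_
      rw [Real.rpow_def_of_pos hM0, mul_one_div_cancel (by linarith)])
  rw [hderiv.deriv, norm_mul, norm_mul, Complex.norm_I, one_mul, Complex.norm_real,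
    Real.norm_eq_abs, abs_of_pos (Real.exp_pos _), div_div_eq_mul_div, div_one] at hcauchy
  have h4 : ‖P.coeff 1‖ = ‖P.coeff 1‖ * Real.exp (-1) * Real.exp 1 := by
    rw [mul_assoc, ← Real.exp_add]; simp
  have h5 : Real.exp 2 = Real.exp 1 * Real.exp 1 := by rw [← Real.exp_add]; norm_num
  rw [h4, h5]
  nlinarith [mul_le_mul_of_nonneg_right hcauchy (Real.exp_pos 1).le]

section Fourier

variable {n : ℕ}

/-- The subset of `[n]` with a given indicator vector. -/
def vecSupport (v : Fin n → ZMod 2) : Finset (Fin n) := Finset.univ.filter (fun i => v i ≠ 0)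

/-- The parity function `χ_S`. -/
def parity (S : Finset (Fin n)) (x : Fin n → Bool) : ℝ := ∏ i ∈ S, signv (x i)

lemma vecSupport_indicatorVec (S : Finset (Fin n)) : vecSupport (indicatorVec S) = S := by
  ext i; simp [vecSupport, indicatorVec]

lemma vecSupport_injective : Function.Injective (vecSupport (n := n)) := by
  intro u v h
  funext i
  have hi : u i ≠ 0 ↔ v i ≠ 0 := by
    simpa [vecSupport] using congrArg (i ∈ ·) h
  generalize u i = a at hi
  generalize v i = b at hi
  revert a b
  decide

lemma abs_signv (b : Bool) : |signv b| = 1 := by cases b <;> simp [signv]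

lemma abs_parity (S : Finset (Fin n)) (x : Fin n → Bool) : |parity S x| = 1 := by
  simp [parity, Finset.abs_prod, abs_signv]

lemma parity_vecSupport_zero (x : Fin n → Bool) : parity (vecSupport 0) x = 1 := by
  simp [parity, vecSupport]

lemma parity_vecSupport_add (u v : Fin n → ZMod 2) (x : Fin n → Bool) :
    parity (vecSupport (u + v)) x = parity (vecSupport u) x * parity (vecSupport v) x := by
  simp only [parity, vecSupport, Finset.prod_filter, ← Finset.prod_mul_distrib]
  refine Finset.prod_congr rfl fun i _ => ?_
  have hs : signv (x i) * signv (x i) = 1 := by cases x i <;> simp [signv]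
  have hadd : ∀ a b : ZMod 2, a + b ≠ 0 ↔ ¬(a ≠ 0 ↔ b ≠ 0) := by decide
  simp only [Pi.add_apply, hadd]
  by_cases hu : u i = 0 <;> by_cases hv : v i = 0 <;> simp [hu, hv, hs]

lemma parity_vecSupport_sum (A : Finset (Fin n → ZMod 2)) (x : Fin n → Bool) :
    parity (vecSupport (∑ v ∈ A, v)) x = ∏ v ∈ A, parity (vecSupport v) x := by
  induction A using Finset.induction_on with
  | empty => simp [parity_vecSupport_zero]
  | insert a s ha ih =>
    rw [Finset.sum_insert ha, Finset.prod_insert ha, parity_vecSupport_add, ih]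

lemma sum_parity_eq_zero {S : Finset (Fin n)} (hS : S.Nonempty) :
    ∑ x : Fin n → Bool, parity S x = 0 := by
  have h := Finset.prod_univ_sum (fun _ : Fin n => (Finset.univ : Finset Bool))
    (fun i b => if i ∈ S then signv b else (1 : ℝ))
  obtain ⟨i, hi⟩ := hS
  rw [Finset.prod_eq_zero (Finset.mem_univ i) (by simp [hi, signv])] at h
  rw [h, Fintype.piFinset_univ]
  exact Finset.sum_congr rfl fun x _ => by simp [parity, Finset.prod_ite_mem]

lemma sum_parity_mul_parity (x y : Fin n → Bool) :
    ∑ S : Finset (Fin n), parity S x * parity S y = if x = y then 2 ^ n else 0 := by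
  have h := Finset.prod_one_add (f := fun i => signv (x i) * signv (y i)) Finset.univ
  simp only [Finset.powerset_univ, Finset.prod_mul_distrib] at h
  rw [show ∑ S : Finset (Fin n), parity S x * parity S y =
    ∏ i, (1 + signv (x i) * signv (y i)) from h.symm]
  split_ifs with hxy
  · subst hxy
    rw [Finset.prod_congr rfl (g := fun _ => (2 : ℝ))]
    · simp
    · intro i _; cases x i <;> norm_num [signv]
  · obtain ⟨i, hi⟩ := Function.ne_iff.1 hxy
    refine Finset.prod_eq_zero (Finset.mem_univ i) ?_
    revert hi
    cases x i <;> cases y i <;> simp [signv]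

lemma fourierCoeff_eq (f : (Fin n → Bool) → ℝ) (S : Finset (Fin n)) :
    fourierCoeff f S = (∑ x, f x * parity S x) / 2 ^ n := rfl

/-- Parseval's identity for Boolean functions. -/
lemma sum_sq_fourierCoeff {f : (Fin n → Bool) → ℝ} (hf : IsBooleanFunc f) :
    ∑ S, fourierCoeff f S ^ 2 = 1 := by
  have hfx : ∀ x, f x * f x = 1 := fun x => by rcases hf x with h | h <;> simp [h]
  have h1 : ∑ S, (∑ x, f x * parity S x) ^ 2 = 2 ^ n * 2 ^ n := by
    calc ∑ S, (∑ x, f x * parity S x) ^ 2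
        = ∑ S, ∑ x, ∑ y, f x * f y * (parity S x * parity S y) := by
          refine Finset.sum_congr rfl fun S _ => ?_
          rw [sq, Finset.sum_mul_sum]
          exact Finset.sum_congr rfl fun x _ => Finset.sum_congr rfl fun y _ => by ring
      _ = ∑ x, ∑ y, f x * f y * ∑ S, parity S x * parity S y := by
          rw [Finset.sum_comm]
          refine Finset.sum_congr rfl fun x _ => ?_
          rw [Finset.sum_comm]
          simp only [Finset.mul_sum]
      _ = 2 ^ n * 2 ^ n := by
          simp [sum_parity_mul_parity, hfx]
  simp only [fourierCoeff_eq, div_pow, ← Finset.sum_div, h1]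
  field_simp

lemma sum_abs_fourierCoeff_le_sqrt_sparsity {f : (Fin n → Bool) → ℝ} (hf : IsBooleanFunc f) :
    ∑ S, |fourierCoeff f S| ≤ √(sparsity f) := by
  have h1 : ∑ S, |fourierCoeff f S| = ∑ S ∈ fourierSupport f, |fourierCoeff f S| := by
    refine (Finset.sum_subset (Finset.subset_univ _) fun S _ hS => ?_).symm
    simpa [fourierSupport] using hS
  rw [h1]
  refine Real.le_sqrt_of_sq_le (sq_sum_le_card_mul_sum_sq.trans ?_)
  have h2 : ∑ S ∈ fourierSupport f, |fourierCoeff f S| ^ 2 ≤ 1 := by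
    rw [← sum_sq_fourierCoeff hf]
    simp only [sq_abs]
    exact Finset.sum_le_sum_of_subset_of_nonneg (Finset.subset_univ _) fun _ _ _ => sq_nonneg _
  exact mul_le_of_le_one_right (Nat.cast_nonneg _) h2

lemma eq_of_sum_eq_of_linearIndepOn {B A A' : Finset (Fin n → ZMod 2)}
    (hB : LinearIndepOn (ZMod 2) id (B : Set (Fin n → ZMod 2)))
    (hA : A ⊆ B) (hA' : A' ⊆ B) (h : ∑ v ∈ A, v = ∑ v ∈ A', v) : A = A' := by
  have h1 := linearIndepOn_finset_iff.1 hB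
    (fun v => (if v ∈ A then 1 else 0) - (if v ∈ A' then 1 else 0)) (by
      simp [sub_smul, ite_smul, Finset.sum_sub_distrib, Finset.sum_ite_mem,
        Finset.inter_eq_right.2 hA, Finset.inter_eq_right.2 hA', h])
  ext v
  by_cases hv : v ∈ B
  · have := h1 v hv
    by_cases ha : v ∈ A <;> by_cases ha' : v ∈ A' <;> simp [ha, ha'] at this ⊢
  · exact ⟨fun h => absurd (hA h) hv, fun h => absurd (hA' h) hv⟩

/-- Riesz product identity. -/
lemma sum_mul_prod_one_add_parity (f : (Fin n → Bool) → ℝ) (B : Finset (Fin n → ZMod 2))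
    (s : (Fin n → ZMod 2) → ℝ) :
    (∑ x, f x * ∏ v ∈ B, (1 + s v * parity (vecSupport v) x)) / 2 ^ n =
      ∑ A ∈ B.powerset, (∏ v ∈ A, s v) * fourierCoeff f (vecSupport (∑ v ∈ A, v)) := by
  simp only [fourierCoeff_eq, ← mul_div_assoc, ← Finset.sum_div, Finset.prod_one_add,
    Finset.mul_sum, parity_vecSupport_sum, Finset.prod_mul_distrib]
  rw [Finset.sum_comm]
  congr 1
  exact Finset.sum_congr rfl fun A _ => Finset.sum_congr rfl fun x _ => by ring

lemma sum_prod_one_add_parity {B : Finset (Fin n → ZMod 2)}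
    (hB : LinearIndepOn (ZMod 2) id (B : Set (Fin n → ZMod 2))) (s : (Fin n → ZMod 2) → ℝ) :
    (∑ x, ∏ v ∈ B, (1 + s v * parity (vecSupport v) x)) / 2 ^ n = 1 := by
  have h := sum_mul_prod_one_add_parity (fun _ => 1) B s
  simp only [one_mul] at h
  rw [h, Finset.sum_eq_single_of_mem ∅ (Finset.empty_mem_powerset B)]
  · simp [fourierCoeff_eq, parity_vecSupport_zero]
  · intro A hA hne
    have hsum : ∑ v ∈ A, v ≠ 0 := fun h0 => hne <|
      eq_of_sum_eq_of_linearIndepOn hB (Finset.mem_powerset.1 hA) (Finset.empty_subset B)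
        (by simpa using h0)
    have hS : (vecSupport (∑ v ∈ A, v)).Nonempty := by
      obtain ⟨i, hi⟩ := Function.ne_iff.1 hsum
      exact ⟨i, by simpa [vecSupport] using hi⟩
    simp [fourierCoeff_eq, sum_parity_eq_zero hS]

lemma abs_sum_mul_prod_one_add_parity_le {f : (Fin n → Bool) → ℝ} (hf : IsBooleanFunc f)
    {B : Finset (Fin n → ZMod 2)}
    (hB : LinearIndepOn (ZMod 2) id (B : Set (Fin n → ZMod 2))) {s : (Fin n → ZMod 2) → ℝ}
    (hs : ∀ v, |s v| ≤ 1) :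
    |(∑ x, f x * ∏ v ∈ B, (1 + s v * parity (vecSupport v) x)) / 2 ^ n| ≤ 1 := by
  have hnonneg : ∀ x, 0 ≤ ∏ v ∈ B, (1 + s v * parity (vecSupport v) x) := by
    refine fun x => Finset.prod_nonneg fun v _ => ?_
    have : |s v * parity (vecSupport v) x| ≤ 1 := by rw [abs_mul, abs_parity, mul_one]; exact hs v
    linarith [(abs_le.1 this).1]
  refine le_of_le_of_eq ?_ (sum_prod_one_add_parity hB s)
  rw [abs_div, abs_of_pos (by positivity : (0 : ℝ) < 2 ^ n)]
  gcongr
  refine (Finset.abs_sum_le_sum_abs _ _).trans (Finset.sum_le_sum fun x _ => ?_)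
  have hfx : |f x| = 1 := by rcases hf x with h | h <;> simp [h]
  rw [abs_mul, hfx, one_mul, abs_of_nonneg (hnonneg x)]

lemma sum_powerset_abs_fourierCoeff_le {f : (Fin n → Bool) → ℝ} (hf : IsBooleanFunc f)
    {B : Finset (Fin n → ZMod 2)}
    (hB : LinearIndepOn (ZMod 2) id (B : Set (Fin n → ZMod 2))) :
    ∑ A ∈ B.powerset, |fourierCoeff f (vecSupport (∑ v ∈ A, v))| ≤ √(sparsity f) := by
  have hinj : Set.InjOn (fun A : Finset (Fin n → ZMod 2) => vecSupport (∑ v ∈ A, v))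
      B.powerset := fun A hA A' hA' h =>
    eq_of_sum_eq_of_linearIndepOn hB (Finset.mem_powerset.1 hA) (Finset.mem_powerset.1 hA')
      (vecSupport_injective h)
  rw [← Finset.sum_image (f := fun S => |fourierCoeff f S|) hinj]
  exact (Finset.sum_le_sum_of_subset_of_nonneg (Finset.subset_univ _)
    fun _ _ _ => abs_nonneg _).trans (sum_abs_fourierCoeff_le_sqrt_sparsity hf)

lemma sum_abs_fourierCoeff_le_four_mul_logb {f : (Fin n → Bool) → ℝ} (hf : IsBooleanFunc f)
    (hk : 2 ≤ sparsity f) {B : Finset (Fin n → ZMod 2)}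
    (hB : LinearIndepOn (ZMod 2) id (B : Set (Fin n → ZMod 2))) :
    ∑ v ∈ B, |fourierCoeff f (vecSupport v)| ≤ 4 * Real.logb 2 (sparsity f) := by
  have hk' : (2 : ℝ) ≤ sparsity f := by exact_mod_cast hk
  have hlog2 : 0 < Real.log 2 := Real.log_pos one_lt_two
  have hM := sum_powerset_abs_fourierCoeff_le hf hB
  set M := √(sparsity f : ℝ) with hMdef
  set s : (Fin n → ZMod 2) → ℝ :=
    fun v => if 0 ≤ fourierCoeff f (vecSupport v) then 1 else -1 with hs
  have hs1 : ∀ v, |s v| = 1 := fun v => by simp only [hs]; split_ifs <;> simp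
  have hs2 : ∀ v, s v * fourierCoeff f (vecSupport v) = |fourierCoeff f (vecSupport v)| := by
    intro v
    simp only [hs]
    split_ifs with h
    · rw [one_mul, abs_of_nonneg h]
    · rw [abs_of_neg (not_le.1 h)]; ring
  set c : Finset (Fin n → ZMod 2) → ℝ :=
    fun A => (∏ v ∈ A, s v) * fourierCoeff f (vecSupport (∑ v ∈ A, v)) with hc
  have hcabs : ∀ A, |c A| = |fourierCoeff f (vecSupport (∑ v ∈ A, v))| := fun A => by
    simp [hc, abs_mul, Finset.abs_prod, hs1]
  set P : Polynomial ℂ :=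
    ∑ A ∈ B.powerset, Polynomial.C (c A : ℂ) * Polynomial.X ^ A.card with hP
  have heval : ∀ z : ℂ, P.eval z = ∑ A ∈ B.powerset, (c A : ℂ) * z ^ A.card := fun z => by
    simp [hP, Polynomial.eval_finsetSum]
  have hdisc : ∀ z : ℂ, ‖z‖ ≤ 1 → ‖P.eval z‖ ≤ M := by
    intro z hz
    rw [heval]
    refine (norm_sum_le _ _).trans (le_trans (Finset.sum_le_sum fun A _ => ?_) hM)
    rw [norm_mul, norm_pow, Complex.norm_real, Real.norm_eq_abs, hcabs]
    exact mul_le_of_le_one_right (abs_nonneg _) (pow_le_one₀ (norm_nonneg _) hz)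
  have hreal : ∀ x : ℝ, |x| ≤ 1 → ‖P.eval (x : ℂ)‖ ≤ 1 := by
    intro x hx
    have h := abs_sum_mul_prod_one_add_parity_le hf hB (s := fun v => x * s v)
      (fun v => by rwa [abs_mul, hs1, mul_one])
    rw [sum_mul_prod_one_add_parity] at h
    have hx' : P.eval (x : ℂ) = ((∑ A ∈ B.powerset, (∏ v ∈ A, x * s v) *
        fourierCoeff f (vecSupport (∑ v ∈ A, v)) : ℝ) : ℂ) := by
      rw [heval]
      push_cast
      refine Finset.sum_congr rfl fun A _ => ?_
      simp only [hc, Finset.prod_mul_distrib, Finset.prod_const]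
      push_cast
      ring
    rwa [hx', Complex.norm_real, Real.norm_eq_abs]
  have hcoeff : P.coeff 1 = ((∑ v ∈ B, |fourierCoeff f (vecSupport v)| : ℝ) : ℂ) := by
    have h1 : P.coeff 1 = ∑ A ∈ B.powersetCard 1, (c A : ℂ) := by
      rw [Finset.powersetCard_eq_filter, Finset.sum_filter, hP, Polynomial.finsetSum_coeff]
      refine Finset.sum_congr rfl fun A _ => ?_
      simp [Polynomial.coeff_X_pow, eq_comm]
    rw [h1, Finset.powersetCard_one, Finset.sum_map]
    push_cast
    exact Finset.sum_congr rfl fun v _ => by simp [hc, ← hs2]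
  have hL0 : 0 ≤ ∑ v ∈ B, |fourierCoeff f (vecSupport v)| :=
    Finset.sum_nonneg fun _ _ => abs_nonneg _
  have hnorm : ‖P.coeff 1‖ = ∑ v ∈ B, |fourierCoeff f (vecSupport v)| := by
    rw [hcoeff, Complex.norm_real, Real.norm_eq_abs, abs_of_nonneg hL0]
  have hexp1 := Real.exp_one_lt_d9
  rw [← hnorm]
  rcases le_or_gt (Real.exp 1) M with hcase | hcase
  · refine (norm_coeff_one_le_exp_two_mul_log P hcase hreal hdisc).trans ?_
    rw [hMdef, Real.log_sqrt (by linarith), Real.logb, ← mul_div_assoc,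
      ← mul_div_assoc, le_div_iff₀ hlog2]
    have hlogk : 0 ≤ Real.log (sparsity f) := Real.log_nonneg (by linarith)
    have hexp2 : Real.exp 2 ≤ 8 := by
      have : Real.exp 2 = Real.exp 1 * Real.exp 1 := by rw [← Real.exp_add]; norm_num
      nlinarith [Real.exp_pos 1]
    have hmul : Real.exp 2 * Real.log 2 ≤ 8 * 1 :=
      mul_le_mul hexp2 (by linarith [Real.log_two_lt_d9]) hlog2.le (by norm_num)
    nlinarith
  · have h1 : ‖P.coeff 1‖ ≤ M := by
      rw [hnorm]
      refine le_trans ?_ hM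
      have hsub : ∑ A ∈ B.powersetCard 1, |fourierCoeff f (vecSupport (∑ v ∈ A, v))| ≤
          ∑ A ∈ B.powerset, |fourierCoeff f (vecSupport (∑ v ∈ A, v))| :=
        Finset.sum_le_sum_of_subset_of_nonneg
          (fun A hA => Finset.mem_powerset.2 (Finset.mem_powersetCard.1 hA).1)
          fun _ _ _ => abs_nonneg _
      simpa [Finset.powersetCard_one] using hsub
    have h2 : 1 ≤ Real.logb 2 (sparsity f) := by
      rw [Real.le_logb_iff_rpow_le one_lt_two (by linarith)]
      simpa using hk'
    linarith

lemma exists_linearIndepOn_card_eq_levelDim {f : (Fin n → Bool) → ℝ} (t : ℝ) :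
    ∃ B : Finset (Fin n → ZMod 2), LinearIndepOn (ZMod 2) id (B : Set (Fin n → ZMod 2)) ∧
      B.card = levelDim f t ∧ ∀ v ∈ B, 1 / t ≤ |fourierCoeff f (vecSupport v)| := by
  obtain ⟨b, hb, hspan, hli⟩ := exists_linearIndependent (ZMod 2)
    (indicatorVec '' {S : Finset (Fin n) | 1 / t ≤ |fourierCoeff f S|})
  have hli' : LinearIndepOn (ZMod 2) id b := hli
  refine ⟨b.toFinset, by simpa using hli', ?_, ?_⟩
  · rw [levelDim, ← hspan, finrank_span_set_eq_card hli']
  · intro v hv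
    obtain ⟨S, hS, rfl⟩ := hb (Set.mem_toFinset.1 hv)
    simpa [vecSupport_indicatorVec] using hS

lemma levelDim_maxSuppEntropy {f : (Fin n → Bool) → ℝ} (hk : 0 < sparsity f) :
    0 < maxSuppEntropy f ∧ levelDim f (maxSuppEntropy f) = fourierRank f := by
  have hbdd : BddAbove ((fun S => 1 / |fourierCoeff f S|) ''
      (fourierSupport f : Set (Finset (Fin n)))) := (Set.toFinite _).bddAbove
  have hmem : ∀ S, S ∈ fourierSupport f ↔ fourierCoeff f S ≠ 0 := by simp [fourierSupport]
  have hle : ∀ S ∈ fourierSupport f, 1 / |fourierCoeff f S| ≤ maxSuppEntropy f :=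
    fun S hS => le_csSup hbdd ⟨S, hS, rfl⟩
  obtain ⟨S₀, hS₀⟩ := Finset.card_pos.1 hk
  have hpos : 0 < maxSuppEntropy f :=
    (one_div_pos.2 (abs_pos.2 ((hmem _).1 hS₀))).trans_le (hle S₀ hS₀)
  refine ⟨hpos, ?_⟩
  have hset : {S : Finset (Fin n) | 1 / maxSuppEntropy f ≤ |fourierCoeff f S|} =
      (fourierSupport f : Set (Finset (Fin n))) := by
    ext S
    simp only [Set.mem_ofPred_eq, Finset.mem_coe]
    constructor
    · intro h
      exact (hmem S).2 (abs_pos.1 ((one_div_pos.2 hpos).trans_le h))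
    · intro h
      exact (one_div_le (abs_pos.2 ((hmem S).1 h)) hpos).1 (hle S h)
  rw [levelDim, fourierRank, hset]

lemma levelDim_le_sq {f : (Fin n → Bool) → ℝ} (hf : IsBooleanFunc f) {t : ℝ} (ht : 0 < t) :
    (levelDim f t : ℝ) ≤ t ^ 2 := by
  obtain ⟨B, -, hcard, hB⟩ := exists_linearIndepOn_card_eq_levelDim (f := f) t
  have h1 : (B.card : ℝ) * (1 / t) ^ 2 ≤ 1 := by
    calc (B.card : ℝ) * (1 / t) ^ 2 = ∑ v ∈ B, (1 / t) ^ 2 := by simp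
      _ ≤ ∑ v ∈ B, fourierCoeff f (vecSupport v) ^ 2 := by
          refine Finset.sum_le_sum fun v hv => ?_
          rw [← sq_abs (fourierCoeff f _)]
          gcongr
          exact hB v hv
      _ = ∑ S ∈ B.image vecSupport, fourierCoeff f S ^ 2 :=
          by rw [Finset.sum_image vecSupport_injective.injOn]
      _ ≤ ∑ S, fourierCoeff f S ^ 2 :=
          Finset.sum_le_sum_of_subset_of_nonneg (Finset.subset_univ _) fun _ _ _ => sq_nonneg _
      _ = 1 := sum_sq_fourierCoeff hf
  rw [← hcard]
  rwa [one_div, inv_pow, ← div_eq_mul_inv, div_le_one (by positivity)] at h1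

lemma levelDim_le_mul_logb {f : (Fin n → Bool) → ℝ} (hf : IsBooleanFunc f)
    (hk : 2 ≤ sparsity f) {t : ℝ} (ht : 0 < t) :
    (levelDim f t : ℝ) ≤ t * (4 * Real.logb 2 (sparsity f)) := by
  obtain ⟨B, hli, hcard, hB⟩ := exists_linearIndepOn_card_eq_levelDim (f := f) t
  have h1 : (B.card : ℝ) * (1 / t) ≤ 4 * Real.logb 2 (sparsity f) := by
    refine le_trans ?_ (sum_abs_fourierCoeff_le_four_mul_logb hf hk hli)
    calc (B.card : ℝ) * (1 / t) = ∑ v ∈ B, 1 / t := by simp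
      _ ≤ _ := Finset.sum_le_sum hB
  rw [← hcard]
  rwa [mul_one_div, div_le_iff₀' ht] at h1

end Fourier

/-- **Lemma.** For every Boolean function `f` with `k(f) ≥ 2`,
`max{√(r(f)), r(f)/(4·log₂ k(f))} ≤ k''(f) ≤ k'(f)`. -/
theorem maxRankEntropy_bounds
    (n : ℕ) (hn : 0 < n) (f : (Fin n → Bool) → ℝ) (hf : IsBooleanFunc f)
    (hk : 2 ≤ sparsity f) :
    max (Real.sqrt (fourierRank f))
        ((fourierRank f : ℝ) / (4 * Real.logb 2 (sparsity f))) ≤ maxRankEntropy f ∧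
    maxRankEntropy f ≤ maxSuppEntropy f := by
  obtain ⟨hpos, hdim⟩ := levelDim_maxSuppEntropy (f := f) (by omega)
  have hlog : 0 < 4 * Real.logb 2 (sparsity f) :=
    mul_pos (by norm_num) (Real.logb_pos one_lt_two (by exact_mod_cast hk))
  refine ⟨le_csInf ⟨_, hpos, hdim⟩ ?_, csInf_le ⟨0, fun t ht => ht.1.le⟩ ⟨hpos, hdim⟩⟩
  rintro t ⟨ht, htd⟩
  rw [← htd]
  exact max_le (Real.sqrt_le_iff.2 ⟨ht.le, levelDim_le_sq hf ht⟩)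
    ((div_le_iff₀ hlog).2 (levelDim_le_mul_logb hf hk ht))

end BoolFunc

end
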